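/- Let G be a finite simple graph on the vertex set {1,…,n} that is chordal, and let C₁,…,C_q be its maximal cliques. Let X be a real symmetric n×n matrix. Then there exists a positive semidefinite real symmetric n×n matrix Y with Y_{ij} = X_{ij} for every i (diagonal entries) and for every edge (i,j) of G, if and only if for every k ∈ {1,…,q} the principal submatrix X_{C_k C_k} (the submatrix of X with rows and columns indexed by C_k) is positive semidefinite. -/

import Mathlib

/-- A finite simple graph is chordal if every cycle of length at least four has a chord,
i.e., an edge of the graph joining two vertices of the cycle that is not an edge of the cycle. -/
def SimpleGraph.IsChordal {V : Type*} (G : SimpleGraph V) : Prop :=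
  ∀ ⦃v : V⦄ (w : G.Walk v v), w.IsCycle → 4 ≤ w.length →
    ∃ x y, x ∈ w.support ∧ y ∈ w.support ∧ G.Adj x y ∧ s(x, y) ∉ w.edges

/-- A maximal clique: a clique not properly contained in another clique. -/
def SimpleGraph.IsMaxClique {V : Type*} (G : SimpleGraph V) (C : Finset V) : Prop :=
  G.IsClique (C : Set V) ∧ ∀ D : Finset V, G.IsClique (D : Set V) → C ⊆ D → C = D

namespace ChordalPSD

open SimpleGraph

/-- In a shortest walk, adjacent vertices are consecutive. -/
lemma geodesic_edges {V : Type*} {H : SimpleGraph V} {x y : V} (p : H.Walk x y)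
    (hp : p.length = H.dist x y) : ∀ u v, u ∈ p.support → v ∈ p.support → H.Adj u v →
      s(u, v) ∈ p.edges := by
  classical
  induction p with
  | nil =>
    intro u v hu hv h
    simp at hu hv
    subst hu; subst hv
    exact absurd h (H.irrefl)
  | @cons x z y h p ih =>
    have hp' : p.length = H.dist z y := by
      refine le_antisymm ?_ (dist_le p)
      obtain ⟨q, hq⟩ := p.reachable.exists_walk_length_eq_dist
      have := dist_le (Walk.cons h q)
      simp at this hp
      omega
    have key : ∀ v, v ∈ p.support → H.Adj x v → v = z := by
      intro v hv hxv
      have h1 := dist_le (Walk.cons hxv (p.dropUntil v hv))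
      have h2 := congrArg Walk.length (p.take_spec hv)
      rw [Walk.length_append] at h2
      rw [Walk.length_cons] at h1 hp
      have h3 : (p.takeUntil v hv).length = 0 := by omega
      exact (Walk.eq_of_length_eq_zero h3).symm
    intro u v hu hv huv
    rw [Walk.support_cons, List.mem_cons] at hu hv
    rw [Walk.edges_cons, List.mem_cons]
    rcases hu with rfl | hu
    · rcases hv with rfl | hv
      · exact absurd huv (H.irrefl)
      · left; rw [key v hv huv]
    · rcases hv with rfl | hv
      · left; rw [key u hu huv.symm, Sym2.eq_swap]
      · right; exact ih hp' u v hu hv huv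

/-- The graph `G` with only the edges inside `W` kept. -/
def restr {V : Type*} (G : SimpleGraph V) (W : Set V) : SimpleGraph V where
  Adj u v := G.Adj u v ∧ u ∈ W ∧ v ∈ W
  symm := ⟨fun _ _ h => ⟨h.1.symm, h.2.2, h.2.1⟩⟩
  loopless := ⟨fun _ h => G.irrefl h.1⟩

lemma restr_le {V : Type*} (G : SimpleGraph V) (W : Set V) : restr G W ≤ G :=
  fun _ _ h => h.1

lemma restr_support {V : Type*} {G : SimpleGraph V} {W : Set V} {x y : V}
    (p : (restr G W).Walk x y) (hx : x ∈ W) : ∀ u ∈ p.support, u ∈ W := by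
  induction p with
  | nil => intro u hu; simp at hu; subst hu; exact hx
  | cons h p ih =>
    intro u hu
    rw [Walk.support_cons, List.mem_cons] at hu
    rcases hu with rfl | hu
    · exact hx
    · exact ih h.2.2 u hu

/-- Induction principle for reachability. -/
lemma reach_ind {V : Type*} {H : SimpleGraph V} {a : V} {P : V → Prop} (h0 : P a)
    (hs : ∀ u v, H.Reachable a u → P u → H.Adj u v → P v) {b : V} (h : H.Reachable a b) : P b := by
  have h' := h
  rw [reachable_iff_reflTransGen] at h'
  induction h' with
  | refl => exact h0
  | tail hab hbc ih =>
    have := (reachable_iff_reflTransGen _ _).2 hab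
    exact hs _ _ this (ih this) hbc

/-- The component of `a` in `G` restricted to `W`. -/
def comp {V : Type*} (G : SimpleGraph V) (W : Set V) (a : V) : Set V :=
  {z | (restr G W).Reachable a z}

lemma comp_sub {V : Type*} {G : SimpleGraph V} {W : Set V} {a : V} (ha : a ∈ W) :
    comp G W a ⊆ W := fun _ hz => reach_ind (H := restr G W) (P := (· ∈ W)) ha (fun _ _ _ _ h => h.2.2) hz

lemma comp_closed {V : Type*} {G : SimpleGraph V} {W : Set V} {a u v : V} (ha : a ∈ W)
    (hu : u ∈ comp G W a) (hv : v ∈ W) (h : G.Adj u v) : v ∈ comp G W a :=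
  Reachable.trans hu (Adj.reachable (G := restr G W) ⟨h, comp_sub ha hu, hv⟩)

lemma comp_reach {V : Type*} {G : SimpleGraph V} {W : Set V} {a z : V}
    (hz : z ∈ comp G W a) (A' : Set V) (hA : comp G W a ⊆ A') : (restr G A').Reachable a z := by
  refine reach_ind (H := restr G W) (Reachable.refl _) ?_ hz
  intro u v hu ih huv
  refine ih.trans (Adj.reachable ⟨huv.1, hA hu, hA ?_⟩)
  exact Reachable.trans hu (Adj.reachable huv)

/-- A shortest path through a component. -/
lemma path_through {V : Type*} {G : SimpleGraph V} {W : Set V} {a x y x1 y1 : V}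
    (hx1 : x1 ∈ comp G W a) (hy1 : y1 ∈ comp G W a) (hx : G.Adj x1 x) (hy : G.Adj y1 y)
    (hxy : x ≠ y) (hn : ¬ G.Adj x y) :
    ∃ p : G.Walk x y, p.IsPath ∧ 2 ≤ p.length ∧
      (∀ u ∈ p.support, u ∈ comp G W a ∨ u = x ∨ u = y) ∧
      (∀ u v, u ∈ p.support → v ∈ p.support → G.Adj u v → s(u, v) ∈ p.edges) := by
  set A' : Set V := {u | u ∈ comp G W a ∨ u = x ∨ u = y} with hA'
  have hsub : comp G W a ⊆ A' := fun u hu => Or.inl hu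
  have hxA : x ∈ A' := Or.inr (Or.inl rfl)
  have hyA : y ∈ A' := Or.inr (Or.inr rfl)
  have r1 := comp_reach hx1 A' hsub
  have r2 := comp_reach hy1 A' hsub
  have r3 : (restr G A').Reachable x1 x := Adj.reachable ⟨hx, hsub hx1, hxA⟩
  have r4 : (restr G A').Reachable y1 y := Adj.reachable ⟨hy, hsub hy1, hyA⟩
  have r : (restr G A').Reachable x y := (r1.trans r3).symm.trans (r2.trans r4)
  obtain ⟨p, hp, hl⟩ := r.exists_path_of_dist
  have hs := restr_support p hxA
  refine ⟨p.mapLe (restr_le G A'), hp.mapLe _, ?_, ?_, ?_⟩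
  · rw [Walk.length_mapLe]
    by_contra hlt
    have : p.length = 0 ∨ p.length = 1 := by omega
    rcases this with h | h
    · exact hxy (Walk.eq_of_length_eq_zero h)
    · exact hn (restr_le G A' (Walk.adj_of_length_eq_one h))
  · rw [Walk.support_mapLe_eq_support]
    exact hs
  · rw [Walk.support_mapLe_eq_support, Walk.edges_mapLe_eq_edges]
    intro u v hu hv huv
    exact geodesic_edges p hl u v hu hv ⟨huv, hs u hu, hs v hv⟩

/-- A vertex of a minimal separator has a neighbour in the component of `a`. -/
lemma nbr_exists {V : Type*} {G : SimpleGraph V} {W : Set V} {a b x : V} (ha : a ∈ W)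
    (hb : b ∉ comp G W a) (h : (restr G (insert x W)).Reachable a b) :
    ∃ z ∈ comp G W a, G.Adj z x := by
  by_contra hcon
  push Not at hcon
  apply hb
  refine reach_ind (P := (· ∈ comp G W a)) (Reachable.refl _) ?_ h
  intro u v _ hu huv
  rcases huv.2.2 with rfl | hv
  · exact absurd huv.1 (hcon u hu)
  · exact comp_closed ha hu hv huv.1

/-- Two nonadjacent vertices in a chordal graph are separated by a clique. -/
lemma exists_clique_sep {V : Type*} [DecidableEq V] {G : SimpleGraph V}
    (hG : G.IsChordal) (S : Finset V) {a b : V} (ha : a ∈ S) (hb : b ∈ S) (hab : a ≠ b)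
    (hn : ¬ G.Adj a b) :
    ∃ T : Finset V, T ⊆ S ∧ a ∉ T ∧ b ∉ T ∧ G.IsClique (T : Set V) ∧
      b ∉ comp G ((S : Set V) \ T) a := by
  let Q : Set (Finset V) := {T | T ⊆ S ∧ a ∉ T ∧ b ∉ T ∧ b ∉ comp G ((S : Set V) \ T) a}
  have hQ : Q.Nonempty := by
    refine ⟨S \ {a, b}, Finset.sdiff_subset, by simp, by simp, ?_⟩
    intro hc
    refine hab.symm (reach_ind (P := (· = a)) rfl ?_ hc)
    rintro u v _ rfl huv
    have := huv.2.2
    simp at this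
    rcases (by tauto : v = u ∨ v = b) with h | h
    · exact h
    · subst h; exact absurd huv.1 hn
  obtain ⟨T, ⟨hTS, haT, hbT, hsep⟩, hmin⟩ := wellFounded_lt.has_min Q hQ
  refine ⟨T, hTS, haT, hbT, ?_, hsep⟩
  set W : Set V := (S : Set V) \ T with hW
  have haW : a ∈ W := ⟨ha, haT⟩
  have hbW : b ∈ W := ⟨hb, hbT⟩
  have hsep' : a ∉ comp G W b := fun h => hsep (Reachable.symm h)
  have hreach : ∀ x ∈ T, (restr G (insert x W)).Reachable a b := by
    intro x hx
    by_contra hcon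
    refine hmin (T.erase x) ⟨(Finset.erase_subset _ _).trans hTS, ?_, ?_, ?_⟩
      (Finset.erase_ssubset hx)
    · simp [haT]
    · simp [hbT]
    · have : ((S : Set V) \ ((T.erase x : Finset V) : Set V)) = insert x W := by
        ext u
        have := hTS hx
        simp only [hW, Set.mem_sdiff, Finset.mem_coe, Finset.mem_erase, Set.mem_insert_iff]
        by_cases hux : u = x
        · subst hux; simp [this]
        · simp [hux]
      rw [this]
      exact hcon
  intro x hx y hy hxy
  by_contra hnxy
  have hx' : x ∈ T := hx
  have hy' : y ∈ T := hy
  obtain ⟨x1, hx1, hx1a⟩ := nbr_exists haW hsep (hreach x hx)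
  obtain ⟨y1, hy1, hy1a⟩ := nbr_exists haW hsep (hreach y hy)
  obtain ⟨x2, hx2, hx2a⟩ := nbr_exists hbW hsep' (hreach x hx).symm
  obtain ⟨y2, hy2, hy2a⟩ := nbr_exists hbW hsep' (hreach y hy).symm
  obtain ⟨p, hp, hpl, hps, hpe⟩ := path_through hx1 hy1 hx1a hy1a hxy hnxy
  obtain ⟨q, hq, hql, hqs, hqe⟩ := path_through hy2 hx2 hy2a hx2a hxy.symm
    (fun h => hnxy h.symm)
  have hxW : ∀ u ∈ W, u ≠ x ∧ u ≠ y := by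
    intro u hu
    exact ⟨fun h => hu.2 (h ▸ hx), fun h => hu.2 (h ▸ hy)⟩
  have hdisj : ∀ u, u ∈ comp G W a → u ∉ comp G W b :=
    fun u h1 h2 => hsep (Reachable.trans h1 (Reachable.symm h2))
  have hxp : x ∉ p.support.tail := by
    have := hp.support_nodup
    rw [← Walk.cons_tail_support, List.nodup_cons] at this
    exact this.1
  have hyq : y ∉ q.support.tail := by
    have := hq.support_nodup
    rw [← Walk.cons_tail_support, List.nodup_cons] at this
    exact this.1
  have hcyc : (p.append q).IsCycle := by
    refine hp.isCycle_append hq ?_ (Or.inl (by omega))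
    intro u hu1 hu2
    have e1 : u ≠ x := fun h => hxp (h ▸ hu1)
    have e2 : u ≠ y := fun h => hyq (h ▸ hu2)
    have h1 := hps u (List.mem_of_mem_tail hu1)
    have h2 := hqs u (List.mem_of_mem_tail hu2)
    have h1' : u ∈ comp G W a := by tauto
    have h2' : u ∈ comp G W b := by tauto
    exact hdisj u h1' h2'
  obtain ⟨u, v, hu, hv, huv, hne⟩ := hG (p.append q) hcyc (by rw [Walk.length_append]; omega)
  rw [Walk.mem_support_append_iff] at hu hv
  rw [Walk.edges_append, List.mem_append, not_or] at hne
  have cross : ∀ u v, u ∈ p.support → v ∈ q.support → G.Adj u v →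
      s(u, v) ∉ p.edges → s(u, v) ∉ q.edges → False := by
    intro u v hu hv huv n1 n2
    rcases hps u hu with h1 | h1
    · rcases hqs v hv with h2 | h2
      · exact hdisj v (comp_closed haW h1 (comp_sub hbW h2) huv) h2
      · refine n1 (hpe u v hu ?_ huv)
        rcases h2 with rfl | rfl
        · exact p.end_mem_support
        · exact p.start_mem_support
    · refine n2 (hqe u v ?_ hv huv)
      rcases h1 with rfl | rfl
      · exact q.end_mem_support
      · exact q.start_mem_support
  rcases hu with hu | hu <;> rcases hv with hv | hv
  · exact hne.1 (hpe u v hu hv huv)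
  · exact cross u v hu hv huv hne.1 hne.2
  · refine cross v u hv hu huv.symm ?_ ?_
    · rw [Sym2.eq_swap]; exact hne.1
    · rw [Sym2.eq_swap]; exact hne.2
  · exact hne.2 (hqe u v hu hv huv)

/-- Two families with the same Gram matrix on `T` differ by an isometry there. -/
lemma exists_isometry {V E : Type*} [Fintype V] [DecidableEq V] [NormedAddCommGroup E]
    [InnerProductSpace ℝ E] [FiniteDimensional ℝ E] (T : Finset V) (u w : V → E)
    (h : ∀ i ∈ T, ∀ j ∈ T, inner ℝ (u i) (u j) = inner ℝ (w i) (w j)) :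
    ∃ U : E →ₗᵢ[ℝ] E, ∀ i ∈ T, U (u i) = w i := by
  let L : (T → ℝ) →ₗ[ℝ] E := Fintype.linearCombination ℝ (fun i : T => u i)
  let M : (T → ℝ) →ₗ[ℝ] E := Fintype.linearCombination ℝ (fun i : T => w i)
  have hLM : ∀ c, ‖L c‖ = ‖M c‖ := by
    intro c
    have : inner ℝ (L c) (L c) = inner ℝ (M c) (M c) := by
      simp only [L, M, Fintype.linearCombination_apply, sum_inner, inner_sum,
        real_inner_smul_left, real_inner_smul_right]
      refine Finset.sum_congr rfl fun i _ => Finset.sum_congr rfl fun j _ => ?_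
      first | rw [h _ i.2 _ j.2] | rw [h _ j.2 _ i.2]
    rw [real_inner_self_eq_norm_sq, real_inner_self_eq_norm_sq] at this
    exact (sq_eq_sq₀ (norm_nonneg _) (norm_nonneg _)).1 this
  obtain ⟨g, hg⟩ := L.rangeRestrict.exists_rightInverse_of_surjective L.range_rangeRestrict
  have hg' : ∀ x : LinearMap.range L, L (g x) = x := by
    intro x
    have := LinearMap.congr_fun hg x
    exact congrArg Subtype.val this
  let f : LinearMap.range L →ₗᵢ[ℝ] E :=
    ⟨M ∘ₗ g, fun x => by
      rw [LinearMap.comp_apply, ← hLM, hg' x]; rfl⟩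
  refine ⟨f.extend, fun i hi => ?_⟩
  have e1 : L (Pi.single ⟨i, hi⟩ 1) = u i := by
    simp [L, Fintype.linearCombination_apply_single]
  have e2 : M (Pi.single ⟨i, hi⟩ 1) = w i := by
    simp [M, Fintype.linearCombination_apply_single]
  let x : LinearMap.range L := ⟨u i, ⟨_, e1⟩⟩
  have e3 : f.extend (u i) = f x := f.extend_apply x
  rw [e3]
  change M (g x) = w i
  rw [← e2, ← sub_eq_zero, ← map_sub, ← norm_eq_zero, ← hLM, map_sub, hg', e1]
  simp [x]

/-- Main induction. -/
lemma exists_vectors {V E : Type*} [Fintype V] [DecidableEq V] [NormedAddCommGroup E]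
    [InnerProductSpace ℝ E] [FiniteDimensional ℝ E] {G : SimpleGraph V} (hG : G.IsChordal)
    (X : V → V → ℝ)
    (hK : ∀ K : Finset V, G.IsClique (K : Set V) →
      ∃ v : V → E, ∀ i ∈ K, ∀ j ∈ K, inner ℝ (v i) (v j) = X i j) (S : Finset V) :
    ∃ v : V → E, ∀ i ∈ S, ∀ j ∈ S, (i = j ∨ G.Adj i j) → inner ℝ (v i) (v j) = X i j := by
  classical
  induction S using Finset.strongInduction with
  | H S ih =>
  by_cases hS : G.IsClique (S : Set V)
  · obtain ⟨v, hv⟩ := hK S hS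
    exact ⟨v, fun i hi j hj _ => hv i hi j hj⟩
  have : ∃ a ∈ S, ∃ b ∈ S, a ≠ b ∧ ¬ G.Adj a b := by
    by_contra hcon
    push Not at hcon
    exact hS fun a ha b hb hab => hcon a ha b hb hab
  obtain ⟨a, ha, b, hb, hab, hn⟩ := this
  obtain ⟨T, hTS, haT, hbT, hT, hsep⟩ := exists_clique_sep hG S ha hb hab hn
  set W : Set V := (S : Set V) \ T with hW
  have haW : a ∈ W := ⟨ha, haT⟩
  set A := comp G W a with hA
  have haA : a ∈ A := Reachable.refl _
  have hAW : A ⊆ W := comp_sub haW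
  let S1 := S.filter (fun i => i ∈ A ∨ i ∈ T)
  let S2 := S.filter (fun i => i ∉ A)
  have m1 : ∀ i, i ∈ S1 ↔ i ∈ S ∧ (i ∈ A ∨ i ∈ T) := fun i => by simp [S1]
  have m2 : ∀ i, i ∈ S2 ↔ i ∈ S ∧ i ∉ A := fun i => by simp [S2]
  have hTA : ∀ i ∈ T, i ∉ A := fun i hi hiA => (hAW hiA).2 hi
  obtain ⟨u, hu⟩ := ih S1 (Finset.ssubset_iff_subset_ne.2 ⟨Finset.filter_subset _ _, fun h => by
    have := (m1 b).1 (h ▸ hb)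
    tauto⟩)
  obtain ⟨w, hw⟩ := ih S2 (Finset.ssubset_iff_subset_ne.2 ⟨Finset.filter_subset _ _, fun h => by
    have := (m2 a).1 (h ▸ ha)
    tauto⟩)
  have hT1 : ∀ i ∈ T, i ∈ S1 := fun i hi => (m1 i).2 ⟨hTS hi, Or.inr hi⟩
  have hT2 : ∀ i ∈ T, i ∈ S2 := fun i hi => (m2 i).2 ⟨hTS hi, hTA i hi⟩
  obtain ⟨U, hU⟩ := exists_isometry T u w (by
    intro i hi j hj
    have : i = j ∨ G.Adj i j := by
      by_cases hij : i = j
      · exact Or.inl hij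
      · exact Or.inr (hT hi hj hij)
    rw [hu i (hT1 i hi) j (hT1 j hj) this, hw i (hT2 i hi) j (hT2 j hj) this])
  have hAT : ∀ i j, i ∈ A → j ∈ S → j ∉ A → G.Adj i j → j ∈ T := by
    intro i j hi hj hjA hij
    by_contra hjT
    exact hjA (comp_closed haW hi ⟨hj, hjT⟩ hij)
  refine ⟨fun i => if i ∈ A then U (u i) else w i, fun i hi j hj hij => ?_⟩
  by_cases hiA : i ∈ A <;> by_cases hjA : j ∈ A
  · simp only [hiA, hjA, if_true, LinearIsometry.inner_map_map]
    exact hu i ((m1 i).2 ⟨hi, Or.inl hiA⟩) j ((m1 j).2 ⟨hj, Or.inl hjA⟩) hij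
  · have hadj : G.Adj i j := hij.resolve_left (fun h => hjA (h ▸ hiA))
    have hjT := hAT i j hiA hj hjA hadj
    simp only [hiA, hjA, if_true, if_false]
    rw [← hU j hjT, LinearIsometry.inner_map_map]
    exact hu i ((m1 i).2 ⟨hi, Or.inl hiA⟩) j (hT1 j hjT) hij
  · have hadj : G.Adj i j := hij.resolve_left (fun h => hiA (h ▸ hjA))
    have hiT := hAT j i hjA hi hiA hadj.symm
    simp only [hiA, hjA, if_true, if_false]
    rw [← hU i hiT, LinearIsometry.inner_map_map]
    exact hu i (hT1 i hiT) j ((m1 j).2 ⟨hj, Or.inl hjA⟩) hij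
  · simp only [hiA, hjA, if_false]
    exact hw i ((m2 i).2 ⟨hi, hiA⟩) j ((m2 j).2 ⟨hj, hjA⟩) hij

open scoped MatrixOrder Matrix.Norms.L2Operator in
/-- A positive semidefinite matrix is a Gram matrix. -/
lemma psd_vectors {V : Type*} [Fintype V] [DecidableEq V] (A : Matrix V V ℝ)
    (hA : A.PosSemidef) :
    ∃ v : V → EuclideanSpace ℝ V, ∀ i j, inner ℝ (v i) (v j) = A i j := by
  obtain ⟨B, rfl⟩ := CStarAlgebra.nonneg_iff_eq_star_mul_self.mp hA.nonneg
  refine ⟨fun i => WithLp.toLp 2 (fun k => B k i), fun i j => ?_⟩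
  simp [Matrix.star_eq_conjTranspose, Matrix.mul_apply, PiLp.inner_apply, mul_comm]

lemma psd_vectors_sub {V : Type*} [Fintype V] [DecidableEq V] (X : Matrix V V ℝ) (K : Finset V)
    (hX : (X.submatrix ((↑) : K → V) ((↑) : K → V)).PosSemidef) :
    ∃ v : V → EuclideanSpace ℝ V, ∀ i ∈ K, ∀ j ∈ K, inner ℝ (v i) (v j) = X i j := by
  let Q : Matrix K V ℝ := fun k v => if (k : V) = v then 1 else 0
  obtain ⟨v, hv⟩ := psd_vectors _ (hX.conjTranspose_mul_mul_same Q)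
  refine ⟨v, fun i hi j hj => ?_⟩
  have key : ∀ (k : K) (i : V) (hi : i ∈ K), Q k i = if k = ⟨i, hi⟩ then 1 else 0 := by
    intro k i hi
    simp only [Q, Subtype.ext_iff]
  rw [hv]
  simp [Matrix.mul_apply, key _ i hi, key _ j hj]

end ChordalPSD

/-- Positive semidefinite completion theorem for chordal graphs (Grone–Johnson–Sá–Wolkowicz):
a partial symmetric matrix specified on the diagonal and the edges of a chordal graph has a
positive semidefinite completion iff all the principal submatrices indexed by the maximal
cliques are positive semidefinite. -/
theorem psd_completion_chordal (n q : ℕ) (G : SimpleGraph (Fin n)) (hG : G.IsChordal)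
    (C : Fin q → Finset (Fin n))
    (hC : ∀ k, G.IsMaxClique (C k))
    (hCall : ∀ D : Finset (Fin n), G.IsMaxClique D → ∃ k, C k = D)
    (X : Matrix (Fin n) (Fin n) ℝ) (hX : X.IsSymm) :
    (∃ Y : Matrix (Fin n) (Fin n) ℝ, Y.PosSemidef ∧ (∀ i, Y i i = X i i) ∧
        ∀ i j, G.Adj i j → Y i j = X i j) ↔
      ∀ k, (X.submatrix ((↑) : (C k) → Fin n) ((↑) : (C k) → Fin n)).PosSemidef := by
  classical
  constructor
  · rintro ⟨Y, hY, hd, he⟩ k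
    have : X.submatrix ((↑) : (C k) → Fin n) ((↑) : (C k) → Fin n) =
        Y.submatrix ((↑) : (C k) → Fin n) ((↑) : (C k) → Fin n) := by
      ext i j
      simp only [Matrix.submatrix_apply]
      by_cases hij : (i : Fin n) = j
      · rw [hij, hd]
      · exact (he _ _ ((hC k).1 i.2 j.2 hij)).symm
    rw [this]
    exact hY.submatrix _
  · intro h
    have hK : ∀ K : Finset (Fin n), G.IsClique (K : Set (Fin n)) →
        ∃ v : Fin n → EuclideanSpace ℝ (Fin n),
          ∀ i ∈ K, ∀ j ∈ K, inner ℝ (v i) (v j) = X i j := by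
      intro K hK
      obtain ⟨D, ⟨hKD, hD⟩, hmax⟩ := wellFounded_gt.has_min
        {D : Finset (Fin n) | K ⊆ D ∧ G.IsClique (D : Set (Fin n))} ⟨K, subset_rfl, hK⟩
      obtain ⟨k, rfl⟩ := hCall D ⟨hD, fun D' hD' hsub => by
        by_contra hne
        exact hmax D' ⟨hKD.trans hsub, hD'⟩ (Finset.ssubset_iff_subset_ne.2 ⟨hsub, hne⟩)⟩
      obtain ⟨v, hv⟩ := ChordalPSD.psd_vectors_sub X (C k) (h k)
      exact ⟨v, fun i hi j hj => hv i (hKD hi) j (hKD hj)⟩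
    obtain ⟨v, hv⟩ := ChordalPSD.exists_vectors hG (fun i j => X i j) hK Finset.univ
    refine ⟨Matrix.gram ℝ v, Matrix.posSemidef_gram ℝ v, fun i => ?_, fun i j hij => ?_⟩
    · exact hv i (Finset.mem_univ _) i (Finset.mem_univ _) (Or.inl rfl)
    · exact hv i (Finset.mem_univ _) j (Finset.mem_univ _) (Or.inr hij)
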